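/- arXiv:2510.12790 — 4 statements merged into one kernel-verified Lean document; each statement's English description precedes it below -/
import Mathlib

section
/- Let σ be a positive definite n×n complex matrix, ψ₁,…,ψ_k unit vectors in ℂⁿ, p₁,…,p_k nonnegative reals, and set ρ = ∑ᵢ pᵢ ψᵢψᵢ*. If λ is a real number with ρ ≤ λσ, then for every i one has pᵢ·⟨ψᵢ, σ⁻¹ψᵢ⟩ ≤ λ. In other words, the max-relative entropy satisfies D∞(ρ‖σ) ≥ ln(maxᵢ pᵢ⟨ψᵢ, σ⁻¹ψᵢ⟩). -/
open Matrix
open scoped ComplexOrder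

/-- Lower bound on the max-relative entropy of a mixture of pure states: if
`ρ = ∑ᵢ pᵢ ψᵢψᵢ* ≤ λσ` with `σ` positive definite and `ψᵢ` unit vectors, then
`pᵢ·⟨ψᵢ, σ⁻¹ψᵢ⟩ ≤ λ` for every `i`. -/
theorem maxRelEnt_mixture_lower_bound
    (n k : ℕ) (σ : Matrix (Fin n) (Fin n) ℂ) (hσ : σ.PosDef)
    (ψ : Fin k → (Fin n → ℂ)) (hψ : ∀ i, star (ψ i) ⬝ᵥ ψ i = 1)
    (p : Fin k → ℝ) (hp : ∀ i, 0 ≤ p i) (l : ℝ)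
    (hρ : ((l : ℂ) • σ -
        ∑ i, (p i : ℂ) • Matrix.vecMulVec (ψ i) (star (ψ i))).PosSemidef) :
    ∀ i, (p i : ℂ) * (star (ψ i) ⬝ᵥ σ⁻¹ *ᵥ ψ i) ≤ (l : ℂ) := by
  intro i
  have hne : ψ i ≠ 0 := by
    intro h
    have := hψ i
    simp [h] at this
  have ha : 0 < star (ψ i) ⬝ᵥ σ⁻¹ *ᵥ ψ i := hσ.inv.dotProduct_mulVec_pos hne
  set x := σ⁻¹ *ᵥ ψ i with hx
  have hdet : IsUnit σ.det := (Matrix.isUnit_iff_isUnit_det σ).1 hσ.isUnit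
  have hσx : σ *ᵥ x = ψ i := by
    rw [hx, Matrix.mulVec_mulVec, Matrix.mul_nonsing_inv _ hdet, Matrix.one_mulVec]
  obtain ⟨r, hr⟩ : ∃ r : ℝ, star (ψ i) ⬝ᵥ x = (r : ℂ) := by
    refine ⟨(star (ψ i) ⬝ᵥ x).re, ?_⟩
    apply Complex.ext
    · simp
    · simpa using (Complex.lt_def.1 ha).2.symm
  have hstar : ∀ j, star x ⬝ᵥ ψ j = star (star (ψ j) ⬝ᵥ x) := by
    intro j
    rw [Matrix.star_dotProduct]
  have h := hρ.dotProduct_mulVec_nonneg x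
  have hterm : ∀ j, star x ⬝ᵥ (((p j : ℂ) • Matrix.vecMulVec (ψ j) (star (ψ j))) *ᵥ x)
      = ((p j * Complex.normSq (star (ψ j) ⬝ᵥ x) : ℝ) : ℂ) := by
    intro j
    rw [Matrix.smul_mulVec, Matrix.vecMulVec_mulVec, dotProduct_smul]
    rw [op_smul_eq_smul, dotProduct_smul, hstar, smul_eq_mul, smul_eq_mul]
    push_cast
    rw [Complex.normSq_eq_conj_mul_self]
    simp only [Complex.star_def]
    ring
  rw [Matrix.sub_mulVec, dotProduct_sub, Matrix.sum_mulVec, dotProduct_sum,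
    Finset.sum_congr rfl (fun j _ => hterm j), Matrix.smul_mulVec, dotProduct_smul, hσx,
    hstar, hr, Complex.star_def, Complex.conj_ofReal, smul_eq_mul] at h
  rw [hr] at ha ⊢
  have hr0 : 0 < r := by exact_mod_cast ha
  have h2 : 0 ≤ l * r - ∑ j, p j * Complex.normSq (star (ψ j) ⬝ᵥ x) := by exact_mod_cast h
  have h3 := Finset.single_le_sum (f := fun j => p j * Complex.normSq (star (ψ j) ⬝ᵥ x))
    (fun j _ => mul_nonneg (hp j) (Complex.normSq_nonneg _)) (Finset.mem_univ i)
  simp only [hr, Complex.normSq_ofReal] at h3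
  have h4 : p i * r ≤ l := by
    by_contra hc
    push Not at hc
    nlinarith [mul_lt_mul_of_pos_right hc hr0]
  exact_mod_cast h4
end

section
/- Let σ be a positive definite n×n complex matrix, ψ₁,…,ψ_k unit vectors in ℂⁿ, p₁,…,p_k nonnegative reals, and set ρ = ∑ᵢ pᵢ ψᵢψᵢ*. Then ρ ≤ (∑ᵢ pᵢ⟨ψᵢ, σ⁻¹ψᵢ⟩)·σ, i.e., the matrix (∑ᵢ pᵢ⟨ψᵢ, σ⁻¹ψᵢ⟩)·σ − ρ is positive semidefinite. In other words, the max-relative entropy satisfies D∞(ρ‖σ) ≤ ln(∑ᵢ pᵢ⟨ψᵢ, σ⁻¹ψᵢ⟩). -/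
open Matrix
open scoped ComplexOrder

theorem single_bound (n : ℕ) (σ : Matrix (Fin n) (Fin n) ℂ) (hσ : σ.PosDef)
    (v : Fin n → ℂ) (hv : v ≠ 0) :
    ((star v ⬝ᵥ σ⁻¹ *ᵥ v) • σ - Matrix.vecMulVec v (star v)).PosSemidef := by
  have hc : 0 < star v ⬝ᵥ σ⁻¹ *ᵥ v := hσ.inv.dotProduct_mulVec_pos hv
  set c := star v ⬝ᵥ σ⁻¹ *ᵥ v with hcdef
  let B : Matrix (Fin n) Unit ℂ := Matrix.replicateCol Unit v
  let D : Matrix Unit Unit ℂ := Matrix.diagonal fun _ => c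
  have hD : D.PosDef := Matrix.PosDef.diagonal fun _ => hc
  have hDe : D = Bᴴ * σ⁻¹ * B := by
    ext i j
    rw [Matrix.mul_assoc]
    simp [D, B, hcdef, Matrix.mul_apply, dotProduct, Matrix.mulVec]
  have : Invertible σ := hσ.isUnit.invertible
  have : Invertible D := hD.isUnit.invertible
  have h1 : (Matrix.fromBlocks σ B Bᴴ D).PosSemidef := by
    rw [Matrix.PosDef.fromBlocks₁₁ B D hσ, ← hDe, sub_self]
    exact Matrix.PosSemidef.zero
  rw [Matrix.PosDef.fromBlocks₂₂ σ B hD] at h1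
  have h2 := h1.smul hc.le
  have hDi : D⁻¹ = Matrix.diagonal fun _ => c⁻¹ := by
    apply Matrix.inv_eq_right_inv
    simp [D, hc.ne']
  have h3 : c • (σ - B * D⁻¹ * Bᴴ) = c • σ - Matrix.vecMulVec v (star v) := by
    rw [hDi, smul_sub]
    congr 1
    ext i j
    have := hc.ne'
    simp [B, Matrix.mul_apply, Matrix.vecMulVec_apply]
    field_simp
  rw [h3] at h2
  exact h2

/-- Upper bound on the max-relative entropy of a mixture of pure states: for
`ρ = ∑ᵢ pᵢ ψᵢψᵢ*` with `σ` positive definite and `ψᵢ` unit vectors,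
`ρ ≤ (∑ᵢ pᵢ⟨ψᵢ, σ⁻¹ψᵢ⟩)·σ`, i.e. `(∑ᵢ pᵢ⟨ψᵢ, σ⁻¹ψᵢ⟩)·σ − ρ` is positive semidefinite. -/
theorem maxRelEnt_mixture_upper_bound
    (n k : ℕ) (σ : Matrix (Fin n) (Fin n) ℂ) (hσ : σ.PosDef)
    (ψ : Fin k → (Fin n → ℂ)) (hψ : ∀ i, star (ψ i) ⬝ᵥ ψ i = 1)
    (p : Fin k → ℝ) (hp : ∀ i, 0 ≤ p i) :
    ((∑ i, (p i : ℂ) * (star (ψ i) ⬝ᵥ σ⁻¹ *ᵥ ψ i)) • σ -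
        ∑ i, (p i : ℂ) • Matrix.vecMulVec (ψ i) (star (ψ i))).PosSemidef := by
  rw [Finset.sum_smul, ← Finset.sum_sub_distrib]
  refine Matrix.posSemidef_sum _ fun i _ => ?_
  rw [mul_smul, ← smul_sub]
  refine (single_bound n σ hσ (ψ i) ?_).smul (by exact_mod_cast hp i)
  intro h
  have := hψ i
  simp [h] at this
end

section
/- Let U be a unitary d×d complex matrix, γ a positive definite d×d complex matrix, and let v ∈ ℂ^d ⊗ ℂ^d be the vector v = (1/√d)·∑ᵢ eᵢ ⊗ (U eᵢ), where (eᵢ) is the standard basis. Then for every real λ, the rank-one matrix vv* satisfies vv* ≤ λ·((1/d)·I_d ⊗ γ) if and only if tr(γ⁻¹) ≤ λ (tr(γ⁻¹) is a positive real number). Equivalently, ⟨v, ((1/d)·I_d ⊗ γ)⁻¹ v⟩ = tr(γ⁻¹). -/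
open Matrix
open scoped ComplexOrder Kronecker

theorem aux_general {n : Type*} [Fintype n] [DecidableEq n] (M : Matrix n n ℂ) (hM : M.PosDef)
    (v : n → ℂ) (hv : v ≠ 0) (l : ℝ) :
    ((l : ℂ) • M - Matrix.vecMulVec v (star v)).PosSemidef ↔ star v ⬝ᵥ M⁻¹ *ᵥ v ≤ (l : ℂ) := by
  have ht : 0 < star v ⬝ᵥ M⁻¹ *ᵥ v := hM.inv.dotProduct_mulVec_pos hv
  obtain ⟨t, htt⟩ : ∃ t : ℝ, star v ⬝ᵥ M⁻¹ *ᵥ v = (t : ℂ) :=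
    ⟨_, (Complex.eq_re_of_ofReal_le (r := 0) (by simpa using ht.le))⟩
  have hMu : IsUnit M.det := (Matrix.isUnit_iff_isUnit_det M).1 hM.isUnit
  rw [htt] at ht ⊢
  have ht0 : 0 < t := by exact_mod_cast ht
  rw [Complex.real_le_real]
  constructor
  · intro h
    have h1 := h.dotProduct_mulVec_nonneg (M⁻¹ *ᵥ v)
    have e1 : star (M⁻¹ *ᵥ v) ⬝ᵥ v = (t : ℂ) := by
      rw [Matrix.star_mulVec, ← Matrix.dotProduct_mulVec, hM.inv.isHermitian.eq, htt]
    rw [Matrix.sub_mulVec, Matrix.smul_mulVec, Matrix.mulVec_mulVec, Matrix.mul_nonsing_inv _ hMu,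
      Matrix.one_mulVec, Matrix.vecMulVec_mulVec, htt, dotProduct_sub, dotProduct_smul, e1] at h1
    simp only [dotProduct_smul, e1] at h1
    have h2 : 0 ≤ l * t - t * t := by
      simp at h1
      exact sub_nonneg.2 (by exact_mod_cast h1)
    nlinarith
  · intro h
    have hA : (Matrix.PosSemidef (Matrix.fromBlocks M (Matrix.replicateCol Unit v)
        (Matrix.replicateCol Unit v)ᴴ ((t : ℂ) • (1 : Matrix Unit Unit ℂ)))) := by
      haveI := hM.isUnit.invertible
      rw [Matrix.PosDef.fromBlocks₁₁ _ _ hM]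
      have hz : (t : ℂ) • (1 : Matrix Unit Unit ℂ) -
          (Matrix.replicateCol Unit v)ᴴ * M⁻¹ * Matrix.replicateCol Unit v = 0 := by
        ext i j
        rw [Matrix.mul_assoc, ← Matrix.replicateCol_mulVec, Matrix.sub_apply, Matrix.mul_apply,
          ← htt]
        simp [dotProduct]
      rw [hz]
      exact Matrix.PosSemidef.zero
    have hD : ((t : ℂ) • (1 : Matrix Unit Unit ℂ)).PosDef := Matrix.PosDef.one.smul ht
    haveI := hD.isUnit.invertible
    rw [Matrix.PosDef.fromBlocks₂₂ _ _ hD] at hA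
    have h3 := (hA.smul ht.le).add (hM.posSemidef.smul (show (0 : ℂ) ≤ ((l - t : ℝ) : ℂ) by
      exact_mod_cast sub_nonneg.2 h))
    have hi : ((t : ℂ) • (1 : Matrix Unit Unit ℂ))⁻¹ = (t : ℂ)⁻¹ • 1 := by
      apply Matrix.inv_eq_right_inv
      rw [Matrix.smul_mul, Matrix.one_mul, smul_smul, mul_inv_cancel₀ ht.ne', one_smul]
    rw [hi] at h3
    refine (congrArg Matrix.PosSemidef ?_).mpr h3
    ext i j
    simp [Matrix.vecMulVec_apply, Matrix.mul_apply]
    field_simp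
    ring

/-- For a unitary `U`, a positive definite `γ`, and the normalized maximally entangled
vector `v = (1/√d)·∑ᵢ eᵢ ⊗ (U eᵢ)`: for every real `λ`,
`vv* ≤ λ·((1/d)·I ⊗ γ)` iff `tr(γ⁻¹) ≤ λ`; equivalently
`⟨v, ((1/d)·I ⊗ γ)⁻¹ v⟩ = tr(γ⁻¹)`. -/
theorem choi_unitary_maxRelEnt
    (d : ℕ) (hd : 1 ≤ d) (U : Matrix (Fin d) (Fin d) ℂ)
    (hU : U ∈ Matrix.unitaryGroup (Fin d) ℂ)
    (γ : Matrix (Fin d) (Fin d) ℂ) (hγ : γ.PosDef)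
    (v : Fin d × Fin d → ℂ)
    (hv : v = ((Real.sqrt d : ℂ))⁻¹ •
      ∑ i : Fin d, (fun pq : Fin d × Fin d =>
        (Pi.single i 1 : Fin d → ℂ) pq.1 * (U *ᵥ (Pi.single i 1 : Fin d → ℂ)) pq.2)) :
    (∀ l : ℝ,
        ((l : ℂ) • (((d : ℂ)⁻¹ • (1 : Matrix (Fin d) (Fin d) ℂ)) ⊗ₖ γ) -
            Matrix.vecMulVec v (star v)).PosSemidef ↔
          γ⁻¹.trace ≤ (l : ℂ)) ∧
      star v ⬝ᵥ (((d : ℂ)⁻¹ • (1 : Matrix (Fin d) (Fin d) ℂ)) ⊗ₖ γ)⁻¹ *ᵥ v = γ⁻¹.trace := by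
  have hd0 : (d : ℂ) ≠ 0 := by
    have : d ≠ 0 := by omega
    exact_mod_cast this
  have hs : ((Real.sqrt d : ℝ) : ℂ) * (Real.sqrt d : ℝ) = d := by
    rw [← Complex.ofReal_mul, Real.mul_self_sqrt (Nat.cast_nonneg d)]; simp
  have hv' : ∀ p q, v (p, q) = ((Real.sqrt d : ℂ))⁻¹ * U q p := by
    intro p q
    subst hv
    simp [Finset.sum_apply, Pi.single_apply]
  have hpos : (((d : ℂ)⁻¹ • (1 : Matrix (Fin d) (Fin d) ℂ)) ⊗ₖ γ).PosDef := by
    refine Matrix.PosDef.kronecker (Matrix.PosDef.one.smul ?_) hγ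
    have : (0 : ℝ) < (d : ℝ)⁻¹ := by positivity
    have h2 : (0 : ℂ) < (((d : ℝ)⁻¹ : ℝ) : ℂ) := by exact_mod_cast this
    simpa using h2
  have key : star v ⬝ᵥ (((d : ℂ)⁻¹ • (1 : Matrix (Fin d) (Fin d) ℂ)) ⊗ₖ γ)⁻¹ *ᵥ v = γ⁻¹.trace := by
    have hi : ((d : ℂ)⁻¹ • (1 : Matrix (Fin d) (Fin d) ℂ))⁻¹ = (d : ℂ) • 1 := by
      apply Matrix.inv_eq_right_inv
      simp [smul_smul, hd0]
    have htr : γ⁻¹.trace = (star U * (γ⁻¹ * U)).trace := by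
      rw [Matrix.trace_mul_comm, Matrix.mul_assoc, Matrix.mem_unitaryGroup_iff.1 hU, Matrix.mul_one]
    rw [Matrix.inv_kronecker, hi, htr]
    simp only [dotProduct, Matrix.mulVec, Matrix.trace, Matrix.diag, Matrix.mul_apply,
      Fintype.sum_prod_type, Pi.star_apply, hv', Matrix.kroneckerMap_apply, Matrix.smul_apply,
      Matrix.one_apply, Matrix.star_apply]
    refine Finset.sum_congr rfl fun p _ => Finset.sum_congr rfl fun q _ => ?_
    rw [Finset.sum_eq_single p (by intro b _ hb; simp [hb.symm]) (by simp), Finset.mul_sum,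
      Finset.mul_sum]
    refine Finset.sum_congr rfl fun r _ => ?_
    have hs0 : ((Real.sqrt d : ℝ) : ℂ) ≠ 0 := by
      intro h; rw [h] at hs; simp at hs; exact hd0 hs.symm
    simp
    field_simp
    rw [pow_two, hs]
    ring
  have hv0 : v ≠ 0 := by
    intro h
    haveI : Nonempty (Fin d) := ⟨⟨0, hd⟩⟩
    have := hγ.inv.trace_pos
    rw [← key, h] at this
    simp at this
  refine ⟨fun l => ?_, key⟩
  rw [aux_general _ hpos v hv0, key]
end

section
/- Let ρ be a positive definite density matrix indexed by (Fin m × Fin n), with partial trace ρ_R = tr₂ ρ over the second factor (which is then a positive definite m×m density matrix). Let γ_R be a positive definite m×m density matrix and γ_A a positive definite n×n density matrix. Then the Umegaki relative entropies satisfy D(ρ ‖ ρ_R ⊗ γ_A) = D(ρ ‖ γ_R ⊗ γ_A) − D(ρ_R ‖ γ_R). -/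
open Matrix
open scoped ComplexOrder Kronecker

/-- Functional-calculus logarithm of a (Hermitian) matrix: if `A = ∑ λᵢ Pᵢ` is the spectral
decomposition, `matLog A = ∑ (Real.log λᵢ) Pᵢ`; junk value `0` on non-Hermitian input. -/
noncomputable def matLog {ι : Type*} [Fintype ι] [DecidableEq ι]
    (A : Matrix ι ι ℂ) : Matrix ι ι ℂ :=
  if h : A.IsHermitian then
    (h.eigenvectorUnitary : Matrix ι ι ℂ) *
      Matrix.diagonal (fun i => (Real.log (h.eigenvalues i) : ℂ)) *
      star (h.eigenvectorUnitary : Matrix ι ι ℂ)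
  else 0

/-- Umegaki relative entropy `D(ρ‖σ) = tr[ρ (log ρ − log σ)]` (as a complex number; it is
real for positive definite arguments). -/
noncomputable def relEnt {ι : Type*} [Fintype ι] [DecidableEq ι]
    (ρ σ : Matrix ι ι ℂ) : ℂ :=
  (ρ * (matLog ρ - matLog σ)).trace

/-- Partial trace over the second tensor factor. -/
noncomputable def ptraceRight {m n : ℕ} (ρ : Matrix (Fin m × Fin n) (Fin m × Fin n) ℂ) :
    Matrix (Fin m) (Fin m) ℂ :=
  Matrix.of fun i j => ∑ k : Fin n, ρ (i, k) (j, k)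

/-- Partial trace over the first tensor factor. -/
noncomputable def ptraceLeft {m n : ℕ} (ρ : Matrix (Fin m × Fin n) (Fin m × Fin n) ℂ) :
    Matrix (Fin n) (Fin n) ℂ :=
  Matrix.of fun k l => ∑ i : Fin m, ρ (i, k) (i, l)


theorem spectral_aux {ι : Type*} [Fintype ι] [DecidableEq ι] {A : Matrix ι ι ℂ}
    (h : A.IsHermitian) :
    A = (h.eigenvectorUnitary : Matrix ι ι ℂ) *
      Matrix.diagonal (fun i => (h.eigenvalues i : ℂ)) *
      star (h.eigenvectorUnitary : Matrix ι ι ℂ) := by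
  conv_lhs => rw [h.spectral_theorem]
  rfl

theorem matLog_eq {ι : Type*} [Fintype ι] [DecidableEq ι] {A V : Matrix ι ι ℂ}
    (h : A.IsHermitian) (hV : V ∈ unitary (Matrix ι ι ℂ)) (d : ι → ℝ)
    (hA : A = V * Matrix.diagonal (fun i => (d i : ℂ)) * star V) :
    matLog A = V * Matrix.diagonal (fun i => (Real.log (d i) : ℂ)) * star V := by
  rw [matLog, dif_pos h]
  have h1 := spectral_aux h
  generalize h.eigenvalues = e at *
  have hU := h.eigenvectorUnitary.2
  generalize (h.eigenvectorUnitary : Matrix ι ι ℂ) = U at *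
  have hU1 : star U * U = 1 := hU.1
  have hU2 : U * star U = 1 := hU.2
  have hV1 : star V * V = 1 := hV.1
  have hV2 : V * star V = 1 := hV.2
  have key : (star V * U) * Matrix.diagonal (fun i => (e i : ℂ))
      = Matrix.diagonal (fun i => (d i : ℂ)) * (star V * U) := by
    calc _ = star V * (U * Matrix.diagonal (fun i => (e i : ℂ)) * star U) * U := by
            simp only [mul_assoc, hU1, mul_one]
      _ = star V * (V * Matrix.diagonal (fun i => (d i : ℂ)) * star V) * U := by
            rw [← h1, ← hA]
      _ = (star V * V) * Matrix.diagonal (fun i => (d i : ℂ)) * (star V * U) := by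
            simp only [mul_assoc]
      _ = _ := by rw [hV1, one_mul]
  have key2 : (star V * U) * Matrix.diagonal (fun i => (Real.log (e i) : ℂ))
      = Matrix.diagonal (fun i => (Real.log (d i) : ℂ)) * (star V * U) := by
    ext i j
    have := congrFun (congrFun key i) j
    rw [Matrix.mul_diagonal, Matrix.diagonal_mul] at this ⊢
    by_cases hw : (star V * U) i j = 0
    · rw [hw]; simp
    · have : (e j : ℂ) = d i := by
        rw [mul_comm] at this
        exact mul_right_cancel₀ hw this
      rw [Complex.ofReal_inj.mp this, mul_comm]
  calc _ = (V * star V) * U * Matrix.diagonal (fun i => (Real.log (e i) : ℂ)) * star U := by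
          rw [hV2, one_mul]
    _ = V * ((star V * U) * Matrix.diagonal (fun i => (Real.log (e i) : ℂ))) * star U := by
          simp only [mul_assoc]
    _ = _ := by rw [key2]; simp only [mul_assoc, hU2, mul_one]

theorem matLog_kronecker {ι κ : Type*} [Fintype ι] [DecidableEq ι] [Fintype κ] [DecidableEq κ]
    {A : Matrix ι ι ℂ} {B : Matrix κ κ ℂ} (hA : A.PosDef) (hB : B.PosDef) :
    matLog (A ⊗ₖ B) = matLog A ⊗ₖ (1 : Matrix κ κ ℂ) + (1 : Matrix ι ι ℂ) ⊗ₖ matLog B := by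
  have hU := hA.1.eigenvectorUnitary.2
  have hV := hB.1.eigenvectorUnitary.2
  have hd : A ⊗ₖ B = ((hA.1.eigenvectorUnitary : Matrix ι ι ℂ) ⊗ₖ
      (hB.1.eigenvectorUnitary : Matrix κ κ ℂ)) *
      Matrix.diagonal (fun p : ι × κ =>
        ((hA.1.eigenvalues p.1 * hB.1.eigenvalues p.2 : ℝ) : ℂ)) *
      star ((hA.1.eigenvectorUnitary : Matrix ι ι ℂ) ⊗ₖ
      (hB.1.eigenvectorUnitary : Matrix κ κ ℂ)) := by
    conv_lhs => rw [spectral_aux hA.1, spectral_aux hB.1]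
    rw [mul_kronecker_mul, mul_kronecker_mul, diagonal_kronecker_diagonal]
    simp only [star_eq_conjTranspose, conjTranspose_kronecker, Complex.ofReal_mul]
  rw [matLog_eq (hA.kronecker hB).1 (kronecker_mem_unitary hU hV) _ hd]
  have hl : Matrix.diagonal (fun p : ι × κ =>
        ((Real.log (hA.1.eigenvalues p.1 * hB.1.eigenvalues p.2) : ℝ) : ℂ))
      = Matrix.diagonal (fun i => (Real.log (hA.1.eigenvalues i) : ℂ)) ⊗ₖ (1 : Matrix κ κ ℂ)
       + (1 : Matrix ι ι ℂ) ⊗ₖ Matrix.diagonal (fun i => (Real.log (hB.1.eigenvalues i) : ℂ)) := by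
    rw [← diagonal_one, ← diagonal_one, diagonal_kronecker_diagonal, diagonal_kronecker_diagonal,
      diagonal_add]
    congr 1
    ext p
    rw [Real.log_mul (hA.eigenvalues_pos _).ne' (hB.eigenvalues_pos _).ne']
    push_cast
    ring
  rw [hl, mul_add, add_mul, matLog, dif_pos hA.1, matLog, dif_pos hB.1]
  simp only [star_eq_conjTranspose, conjTranspose_kronecker, ← mul_kronecker_mul, mul_one]
  simp only [← star_eq_conjTranspose]
  rw [Unitary.mul_star_self_of_mem hU, Unitary.mul_star_self_of_mem hV]

theorem ptraceRight_posDef {m n : ℕ} (hn : 0 < n)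
    {ρ : Matrix (Fin m × Fin n) (Fin m × Fin n) ℂ} (hρ : ρ.PosDef) :
    (ptraceRight ρ).PosDef := by
  have : ptraceRight ρ = ∑ k : Fin n, ρ.submatrix (fun i => (i, k)) (fun i => (i, k)) := by
    ext i j
    simp [ptraceRight, Matrix.sum_apply]
  rw [this]
  exact Matrix.posDef_sum ⟨⟨0, hn⟩, Finset.mem_univ _⟩
    (fun k _ => hρ.submatrix (fun a b h => (Prod.mk.inj h).1))

theorem trace_mul_kron_one {m n : ℕ} (ρ : Matrix (Fin m × Fin n) (Fin m × Fin n) ℂ)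
    (X : Matrix (Fin m) (Fin m) ℂ) :
    (ρ * (X ⊗ₖ (1 : Matrix (Fin n) (Fin n) ℂ))).trace = (ptraceRight ρ * X).trace := by
  simp only [Matrix.trace, Matrix.diag, Matrix.mul_apply, Fintype.sum_prod_type, ptraceRight,
    Matrix.kroneckerMap_apply, Matrix.one_apply, Matrix.of_apply, mul_ite, mul_one, mul_zero,
    Finset.sum_ite_eq', Finset.mem_univ, if_true, Finset.sum_mul]
  refine Finset.sum_congr rfl fun i _ => ?_
  rw [Finset.sum_comm]

/-- For a positive definite bipartite density matrix `ρ` with reduced state `ρ_R`, and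
positive definite density matrices `γ_R`, `γ_A`:
`D(ρ ‖ ρ_R ⊗ γ_A) = D(ρ ‖ γ_R ⊗ γ_A) − D(ρ_R ‖ γ_R)`. -/
theorem relEnt_reduced_decomposition
    (m n : ℕ) (ρ : Matrix (Fin m × Fin n) (Fin m × Fin n) ℂ)
    (hρ : ρ.PosDef) (hρtr : ρ.trace = 1)
    (γR : Matrix (Fin m) (Fin m) ℂ) (hγR : γR.PosDef) (hγRtr : γR.trace = 1)
    (γA : Matrix (Fin n) (Fin n) ℂ) (hγA : γA.PosDef) (hγAtr : γA.trace = 1) :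
    relEnt ρ ((ptraceRight ρ) ⊗ₖ γA) = relEnt ρ (γR ⊗ₖ γA) - relEnt (ptraceRight ρ) γR := by
  have hn : 0 < n := by
    rcases Nat.eq_zero_or_pos n with rfl | h
    · simp [Matrix.trace] at hγAtr
    · exact h
  have hR := ptraceRight_posDef hn hρ
  simp only [relEnt]
  rw [matLog_kronecker hR hγA, matLog_kronecker hγR hγA]
  simp only [mul_sub, mul_add, Matrix.trace_sub, Matrix.trace_add, trace_mul_kron_one]
  ring
end
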